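/- Assume the standing setup. Let m be a U-rich direction and let w_m be the number of U-rich lines with slope m. Then: (i) every line with slope m that is not U-rich meets U in at most n - w_m points; (ii) every U-rich line with slope m meets U in at least p - r + n - 1 points; (iii) w_m ≤ n - 1; and (iv) r ≥ w_m·(n - w_m) ≥ n - 1. -/

import Mathlib

open Finset Polynomial

attribute [local instance] Classical.propDecidable

/-- The line in `(ZMod p)²` with slope `m` (where `none` denotes the vertical
slope `∞`) and "intercept" `c`. -/
noncomputable def lineWithSlope (p : ℕ) [NeZero p] (m : Option (ZMod p)) (c : ZMod p) :
    Finset (ZMod p × ZMod p) :=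
  match m with
  | some m => Finset.univ.filter fun q => q.2 = m * q.1 + c
  | none => Finset.univ.filter fun q => q.1 = c

/-- `ℓ` is `U`-rich: it meets `U` in at least `#U/p + 1` points. -/
def IsRich (p : ℕ) (U ℓ : Finset (ZMod p × ZMod p)) : Prop :=
  (U.card : ℚ) / p + 1 ≤ ((ℓ ∩ U).card : ℚ)

/-- `ℓ` is `U`-poor: it meets `U` in at most `#U/p - 1` points. -/
def IsPoor (p : ℕ) (U ℓ : Finset (ZMod p × ZMod p)) : Prop :=
  ((ℓ ∩ U).card : ℚ) ≤ (U.card : ℚ) / p - 1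

/-- `m` is a `U`-rich direction: some line with slope `m` is `U`-rich. -/
def IsRichDir (p : ℕ) [NeZero p] (U : Finset (ZMod p × ZMod p))
    (m : Option (ZMod p)) : Prop :=
  ∃ c : ZMod p, IsRich p U (lineWithSlope p m c)

/-- `m` is a `U`-special direction: some line with slope `m` is `U`-rich or `U`-poor. -/
def IsSpecialDir (p : ℕ) [NeZero p] (U : Finset (ZMod p × ZMod p))
    (m : Option (ZMod p)) : Prop :=
  ∃ c : ZMod p, IsRich p U (lineWithSlope p m c) ∨ IsPoor p U (lineWithSlope p m c)

def WtLE {K : Type*} [Field K] (d : ℕ) (w : ℤ) (P : K[X][X]) : Prop :=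
  ∀ i j : ℕ, w < i + d * j → (P.coeff j).coeff i = 0

section Weight
variable {K : Type*} [Field K] {d : ℕ} {u v w : ℤ} {P Q M : K[X][X]}

theorem WtLE.mono (h : WtLE d u P) (huv : u ≤ v) : WtLE d v P :=
  fun i j hij => h i j (by omega)

theorem WtLE.add (hP : WtLE d w P) (hQ : WtLE d w Q) : WtLE d w (P + Q) := by
  intro i j hij
  simp [hP i j hij, hQ i j hij]

theorem WtLE.sub (hP : WtLE d w P) (hQ : WtLE d w Q) : WtLE d w (P - Q) := by
  intro i j hij
  simp [hP i j hij, hQ i j hij]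

theorem WtLE.mul (hP : WtLE d u P) (hQ : WtLE d v Q) : WtLE d (u + v) (P * Q) := by
  intro i j hij
  rw [coeff_mul, finsetSum_coeff]
  refine sum_eq_zero fun x hx => ?_
  rw [coeff_mul]
  refine sum_eq_zero fun y hy => ?_
  rw [HasAntidiagonal.mem_antidiagonal] at hx hy
  by_cases h : u < y.1 + d * x.1
  · rw [hP _ _ h, zero_mul]
  · rw [hQ y.2 x.2, mul_zero]
    rw [← hx, ← hy] at hij
    push_cast at hij
    linarith

theorem WtLE.prod {ι : Type*} (s : Finset ι) (f : ι → K[X][X]) (c : ℤ)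
    (h : ∀ i ∈ s, WtLE d c (f i)) : WtLE d (s.card * c) (∏ i ∈ s, f i) := by
  induction s using Finset.induction_on with
  | empty =>
    intro i j hij
    simp only [prod_empty, coeff_one]
    split_ifs with hj
    · rw [coeff_one, if_neg]
      rintro rfl
      subst hj
      simp at hij
    · simp
  | insert a s ha ih =>
    rw [prod_insert ha, card_insert_of_notMem ha]
    exact ((h a (mem_insert_self _ _)).mul (ih fun i hi => h i (mem_insert_of_mem hi))).mono
      (by push_cast; linarith)

theorem wtLE_C {a : K[X]} (h : (a.natDegree : ℤ) ≤ w) : WtLE d w (C a) := by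
  intro i j hij
  rw [coeff_C]
  split_ifs with hj
  · subst hj
    refine coeff_eq_zero_of_natDegree_lt ?_
    simp only [Nat.cast_zero, mul_zero, add_zero] at hij
    omega
  · simp

theorem wtLE_X : WtLE d d (X : K[X][X]) := by
  intro i j hij
  rw [coeff_X]
  split_ifs with hj
  · subst hj
    rw [coeff_one, if_neg]
    rintro rfl
    simp at hij
  · simp

/-- The substitution `X ↦ X T`, `S ↦ S T ^ d`, which turns the weight into the degree in `T`. -/
noncomputable def weightHom (K : Type*) [Field K] (d : ℕ) : K[X][X] →+* K[X][X][X] :=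
  eval₂RingHom (S := K[X][X][X]) (eval₂RingHom (S := K[X][X][X]) (C.comp (C.comp C))
    (C (C X) * X)) (C X * X ^ d)

theorem coeff_weightHom (P : K[X][X]) (i j k : ℕ) :
    (((weightHom K d P).coeff k).coeff j).coeff i =
      if k = i + d * j then (P.coeff j).coeff i else 0 := by
  induction P using Polynomial.induction_on' with
  | add P Q hP hQ => simp only [map_add, coeff_add, hP, hQ]; split_ifs <;> simp
  | monomial j' a =>
    induction a using Polynomial.induction_on' with
    | add a b ha hb => simp only [map_add, coeff_add, ha, hb]; split_ifs <;> simp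
    | monomial i' c =>
      have : weightHom K d (monomial j' (monomial i' c)) =
          monomial (i' + d * j') (monomial j' (monomial i' c)) := by
        simp only [weightHom, coe_eval₂RingHom, ← C_mul_X_pow_eq_monomial, map_mul, map_pow,
          eval₂_C, eval₂_X, RingHom.comp_apply]
        ring
      rw [this]
      simp only [coeff_monomial]
      by_cases h1 : j' = j <;> by_cases h2 : i' = i <;> by_cases h3 : i' + d * j' = k <;>
        simp_all [coeff_monomial, eq_comm]

theorem wtLE_iff_natDegree_weightHom (w : ℕ) :
    WtLE d w P ↔ (weightHom K d P).natDegree ≤ w := by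
  rw [natDegree_le_iff_coeff_eq_zero]
  constructor
  · intro h k hk
    ext j i
    rw [coeff_weightHom]
    split_ifs with hkk
    · rw [h i j (by rw [hkk] at hk; exact_mod_cast hk)]; simp
    · simp
  · intro h i j hij
    have := coeff_weightHom (d := d) P i j (i + d * j)
    rw [if_pos rfl, h _ (by exact_mod_cast hij)] at this
    simpa using this.symm

theorem WtLE.of_mul (h : WtLE d w (P * Q)) {i j : ℕ} (hQ : (Q.coeff j).coeff i ≠ 0) :
    WtLE d (w - (i + d * j)) P := by
  by_cases hP : P = 0
  · subst hP; intro i j _; simp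
  have hφ : ∀ {A : K[X][X]}, A ≠ 0 → weightHom K d A ≠ 0 := by
    intro A hA h0
    refine hA ?_
    ext j i
    have := coeff_weightHom (d := d) A i j (i + d * j)
    rw [if_pos rfl, h0] at this
    simpa using this.symm
  have hQ0 : Q ≠ 0 := by rintro rfl; simp at hQ
  have hmul := natDegree_mul (hφ hP) (hφ hQ0)
  rw [← map_mul] at hmul
  have hQd : i + d * j ≤ (weightHom K d Q).natDegree := by
    refine le_natDegree_of_ne_zero fun h0 => hQ ?_
    have := coeff_weightHom (d := d) Q i j (i + d * j)
    rw [if_pos rfl, h0] at this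
    simpa using this.symm
  have hw0 : 0 ≤ w := by
    by_contra hw
    refine mul_ne_zero hP hQ0 ?_
    ext j i
    rw [h i j (lt_of_lt_of_le (not_le.1 hw) (by positivity))]
    simp
  lift w to ℕ using hw0
  rw [wtLE_iff_natDegree_weightHom] at h
  have hle : WtLE d ((weightHom K d P).natDegree : ℕ) P :=
    (wtLE_iff_natDegree_weightHom _).2 le_rfl
  refine hle.mono ?_
  have hQd' : ((i : ℤ) + d * j) ≤ ((weightHom K d Q).natDegree : ℤ) := by exact_mod_cast hQd
  have hmul' : (((weightHom K d P).natDegree : ℤ) + (weightHom K d Q).natDegree) ≤ w := by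
    exact_mod_cast hmul ▸ h
  linarith

theorem WtLE.exists_div (hM : M.Monic) (hMw : WtLE d (d * M.natDegree) M) (hP : WtLE d w P) :
    WtLE d (w - d * M.natDegree) (P /ₘ M) ∧ WtLE d w (P %ₘ M) := by
  induction hk : P.degree using WellFoundedLT.induction generalizing P with
  | ind k ih =>
  by_cases hdeg : P.degree < M.degree
  · rw [(divByMonic_eq_zero_iff hM).2 hdeg, (modByMonic_eq_self_iff hM).2 hdeg]
    exact ⟨fun i j _ => by simp, hP⟩
  push Not at hdeg
  have hP0 : P ≠ 0 := by
    rintro rfl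
    simp [hM.ne_zero] at hdeg
  have hnat : M.natDegree ≤ P.natDegree := natDegree_le_natDegree hdeg
  set q : K[X][X] := C P.leadingCoeff * X ^ (P.natDegree - M.natDegree) with hq
  have hlt : (P - M * q).degree < P.degree := div_wf_lemma ⟨hdeg, hP0⟩ hM
  have hqw : WtLE d (w - d * M.natDegree) q := by
    intro i j hij
    rw [hq, coeff_C_mul_X_pow]
    split_ifs with hj
    · refine hP i P.natDegree ?_
      have : P.natDegree = j + M.natDegree := by omega
      rw [this]; push_cast; linarith
    · simp
  have hP' : WtLE d w (P - M * q) := hP.sub ((hMw.mul hqw).mono (by linarith))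
  obtain ⟨h1, h2⟩ := ih _ (hk ▸ hlt) hP' rfl
  obtain ⟨e1, e2⟩ := div_modByMonic_unique (f := P) (q + (P - M * q) /ₘ M) ((P - M * q) %ₘ M) hM
    ⟨by linear_combination modByMonic_add_div (P - M * q) M, degree_modByMonic_lt _ hM⟩
  rw [e1, e2]
  exact ⟨hqw.add h1, h2⟩
end Weight

section Elimination
variable {K : Type*} [Field K] {d : ℕ} {w β : ℤ} {A B : K[X][X]}

theorem natDegree_det_le_of_weights {a : ℕ} (N : Matrix (Fin a) (Fin a) K[X])
    (hN : ∀ i j k : ℕ, ∀ (hi : i < a) (hj : j < a), β + d * j < k + d * i →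
      (N ⟨i, hi⟩ ⟨j, hj⟩).coeff k = 0) (hdet : N.det ≠ 0) :
    (N.det.natDegree : ℤ) ≤ a * β := by
  by_contra hlt
  push Not at hlt
  have hlc : N.det.coeff N.det.natDegree ≠ 0 := by
    simpa using hdet
  refine hlc ?_
  set k := N.det.natDegree
  rw [Matrix.det_apply, finsetSum_coeff]
  refine sum_eq_zero fun σ _ => ?_
  rw [Units.smul_def, coeff_smul]
  suffices h : (∏ i, N (σ i) i).coeff k = 0 by rw [h, smul_zero]
  by_cases h0 : ∃ i, N (σ i) i = 0
  · obtain ⟨i, hi⟩ := h0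
    have : ∏ i, N (σ i) i = 0 := prod_eq_zero (mem_univ i) hi
    rw [this, coeff_zero]
  push Not at h0
  refine coeff_eq_zero_of_natDegree_lt ?_
  rw [natDegree_prod _ _ fun i _ => h0 i]
  have hle : ∀ i : Fin a, ((N (σ i) i).natDegree : ℤ) ≤ β + d * i - d * (σ i : ℕ) := by
    intro i
    by_contra hi
    push Not at hi
    have := hN (σ i) i (N (σ i) i).natDegree (σ i).2 i.2 (by linarith)
    exact h0 i (by simpa using this)
  have hsum : ((∑ i, (N (σ i) i).natDegree : ℕ) : ℤ) ≤ a * β := by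
    push_cast
    refine (sum_le_sum fun i _ => hle i).trans_eq ?_
    rw [sum_sub_distrib, sum_add_distrib, ← mul_sum, ← mul_sum,
      Equiv.sum_comp σ (fun i : Fin a => ((i : ℕ) : ℤ))]
    simp
  exact_mod_cast hsum.trans_lt hlt

/-- A weighted form of the resultant: if the prime `A`, monic in the outer variable, does not
divide `B`, then the ideal `(A, B)` contains a nonzero polynomial in the inner variable alone, of
degree at most the weighted Bézout bound. -/
theorem exists_C_eq_mul_add_mul (hA : A.Monic) (hAp : Prime A)
    (hAw : WtLE d (d * A.natDegree) A) (hB : WtLE d β B) (hdvd : ¬ A ∣ B) :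
    ∃ (u v : K[X][X]) (D : K[X]), D ≠ 0 ∧ (D.natDegree : ℤ) ≤ A.natDegree * β ∧
      C D = u * A + v * B := by
  set a := A.natDegree with ha
  set N : Matrix (Fin a) (Fin a) K[X] := fun i j => ((B * X ^ (j : ℕ)) %ₘ A).coeff i with hNdef
  have hA1 : A ≠ 1 := fun h => hAp.not_isUnit (h ▸ isUnit_one)
  have ha0 : 0 < a := by
    rw [ha]
    exact Nat.pos_of_ne_zero fun h => hA1 (hA.natDegree_eq_zero.1 h)
  -- multiplication by `B` modulo `A`
  have hmul : ∀ c : Fin a → K[X], A ∣ B * (∑ j : Fin a, C (c j) * X ^ (j : ℕ)) -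
      ∑ i : Fin a, C (N.mulVec c i) * X ^ (i : ℕ) := by
    intro c
    have hmod : ∀ j : Fin a, ∑ i : Fin a, C (N i j) * X ^ (i : ℕ) = (B * X ^ (j : ℕ)) %ₘ A := by
      intro j
      have hd : ((B * X ^ (j : ℕ)) %ₘ A).natDegree < a :=
        natDegree_modByMonic_lt _ hA hA1
      conv_rhs => rw [as_sum_range_C_mul_X_pow' _ hd]
      rw [← Fin.sum_univ_eq_sum_range fun i => C (((B * X ^ (j : ℕ)) %ₘ A).coeff i) * X ^ i]
    have hre : ∑ i : Fin a, C (N.mulVec c i) * X ^ (i : ℕ) =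
        ∑ j : Fin a, C (c j) * ((B * X ^ (j : ℕ)) %ₘ A) := by
      simp_rw [← hmod, mul_sum, Matrix.mulVec, dotProduct, map_sum, sum_mul]
      rw [sum_comm]
      refine sum_congr rfl fun j _ => sum_congr rfl fun i _ => ?_
      rw [C_mul]; ring
    rw [hre, mul_sum, ← sum_sub_distrib]
    refine dvd_sum fun j _ => ?_
    refine ⟨C (c j) * ((B * X ^ (j : ℕ)) /ₘ A), ?_⟩
    linear_combination -C (c j) * modByMonic_add_div (B * X ^ (j : ℕ)) A
  have hdet : N.det ≠ 0 := by
    intro h0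
    obtain ⟨c, hc0, hc⟩ := Matrix.exists_mulVec_eq_zero_iff.2 h0
    have h1 := hmul c
    rw [hc] at h1
    simp only [Pi.zero_apply, map_zero, zero_mul, sum_const_zero, sub_zero] at h1
    rcases hAp.dvd_or_dvd h1 with h | h
    · exact hdvd h
    have hdeg : (∑ j : Fin a, C (c j) * X ^ (j : ℕ)).degree < A.degree := by
      rw [degree_eq_natDegree hA.ne_zero, ← ha]
      refine degree_sum_fin_lt c
    have hz := eq_zero_of_dvd_of_degree_lt h hdeg
    refine hc0 (funext fun j => ?_)
    have := congrArg (fun P => P.coeff (j : ℕ)) hz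
    simpa [finsetSum_coeff, coeff_C_mul, coeff_X_pow, Fin.val_inj] using this
  obtain ⟨q, hq⟩ := hmul (N.adjugate.mulVec (Pi.single ⟨0, ha0⟩ 1))
  have hsum : ∑ i : Fin a, C ((N.mulVec (N.adjugate.mulVec (Pi.single ⟨0, ha0⟩ 1))) i) *
      X ^ (i : ℕ) = C N.det := by
    rw [Matrix.mulVec_mulVec, Matrix.mul_adjugate, Matrix.smul_mulVec, Matrix.one_mulVec,
      sum_eq_single ⟨0, ha0⟩]
    · simp
    · intro i _ hi
      simp [Pi.single_eq_of_ne hi]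
    · simp
  rw [hsum] at hq
  refine ⟨-q, ∑ j, C (N.adjugate.mulVec (Pi.single ⟨0, ha0⟩ 1) j) * X ^ (j : ℕ), N.det, hdet,
    natDegree_det_le_of_weights (d := d) N ?_ hdet, by linear_combination -hq⟩
  intro i j k hi hj hk
  have hX : WtLE d (β + d * j) (B * X ^ j) := by
    refine hB.mul ?_
    have := WtLE.prod (d := d) (range j) (fun _ => (X : K[X][X])) d fun _ _ => wtLE_X
    simp only [prod_const, card_range] at this
    exact this.mono (by rw [mul_comm])
  exact (WtLE.exists_div hA hAw hX).2 k i hk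
end Elimination

section InnerDerivative
variable {K : Type*} [Field K] {d : ℕ} {w : ℤ}

/-- The derivative with respect to the inner variable. -/
noncomputable def innerDeriv (P : K[X][X]) : K[X][X] :=
  ∑ j ∈ range (P.natDegree + 1), C (derivative (P.coeff j)) * X ^ j

theorem coeff_innerDeriv (P : K[X][X]) (j : ℕ) :
    (innerDeriv P).coeff j = derivative (P.coeff j) := by
  simp only [innerDeriv, finsetSum_coeff, coeff_C_mul_X_pow]
  rw [sum_ite_eq (range (P.natDegree + 1)) j]
  split_ifs with h
  · rfl
  · rw [coeff_eq_zero_of_natDegree_lt, derivative_zero]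
    simpa using h

theorem eval_innerDeriv (P : K[X][X]) (x : K) :
    (innerDeriv P).eval (C x) = derivative (P.eval (C x)) := by
  rw [eval_eq_sum_range (p := P), innerDeriv, eval_finsetSum, derivative_sum]
  refine sum_congr rfl fun j _ => ?_
  rw [← C_pow, derivative_mul, derivative_C]
  simp

theorem WtLE.innerDeriv {P : K[X][X]} (h : WtLE d w P) : WtLE d (w - 1) (innerDeriv P) := by
  intro i j hij
  rw [coeff_innerDeriv, coeff_derivative, h _ _ (by push_cast; linarith), zero_mul]

theorem degree_innerDeriv_lt {P : K[X][X]} (hP : P.Monic) :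
    (innerDeriv P).degree < P.degree := by
  rw [degree_eq_natDegree hP.ne_zero, degree_lt_iff_coeff_zero]
  intro j hj
  rw [coeff_innerDeriv]
  rcases hj.eq_or_lt with h | h
  · rw [← h, hP.coeff_natDegree, derivative_one]
  · rw [coeff_eq_zero_of_natDegree_lt h, derivative_zero]

theorem WtLE.natDegree_eval_le {P : K[X][X]} {w : ℕ} (h : WtLE d w P) (x : K) :
    (P.eval (C x)).natDegree ≤ w := by
  rw [eval_eq_sum_range]
  refine natDegree_sum_le_of_forall_le _ _ fun j _ => ?_
  rw [← C_pow]
  refine (natDegree_mul_C_le _ _).trans ?_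
  rw [natDegree_le_iff_coeff_eq_zero]
  intro i hi
  exact h i j (by have : (0 : ℤ) ≤ d * j := by positivity
                  omega)

end InnerDerivative

section LineMultiplicity
variable {p : ℕ} [Fact p.Prime] {d r n : ℕ} {A B : (ZMod p)[X][X]}

/-- The multiplicity, capped at `p`, with which the curve `A = 0` meets the line `S = x` at the
point `X = x`. -/
noncomputable def lineMult (A : (ZMod p)[X][X]) (x : ZMod p) : ℕ :=
  if A.eval (C x) = 0 then p else (A.eval (C x)).rootMultiplicity x

theorem lineMult_mul_le (A B : (ZMod p)[X][X]) (x : ZMod p) :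
    lineMult (A * B) x ≤ lineMult A x + lineMult B x := by
  unfold lineMult
  rw [eval_mul]
  by_cases hA : A.eval (C x) = 0
  · simp [hA]
  by_cases hB : B.eval (C x) = 0
  · simp [hB]
  rw [if_neg hA, if_neg hB, if_neg (mul_ne_zero hA hB), rootMultiplicity_mul (mul_ne_zero hA hB)]

theorem lineMult_X_sub_C_X (x : ZMod p) : lineMult (X - C X) x = 1 := by
  have h : (X - C X : (ZMod p)[X][X]).eval (C x) = C (-1) * (X - C x) := by
    simp
  have h0 : C (-1 : ZMod p) * (X - C x) ≠ 0 :=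
    mul_ne_zero (by simp) (X_sub_C_ne_zero x)
  rw [lineMult, h, if_neg h0, rootMultiplicity_mul h0, rootMultiplicity_C,
    rootMultiplicity_X_sub_C_self]

theorem lineMult_X_sub_C_C (x₀ x : ZMod p) :
    lineMult (X - C (C x₀)) x = if x = x₀ then p else 0 := by
  have h : (X - C (C x₀) : (ZMod p)[X][X]).eval (C x) = C (x - x₀) := by
    simp
  rw [lineMult, h, rootMultiplicity_C]
  simp [sub_eq_zero]

theorem natDegree_eq_zero_of_derivative_eq_zero_of_lt {f : (ZMod p)[X]} (hf : derivative f = 0)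
    (hp : f.natDegree < p) : f.natDegree = 0 := by
  by_contra h0
  obtain ⟨m, hm⟩ := Nat.exists_eq_succ_of_ne_zero h0
  have h1 : (derivative f).coeff m = 0 := by rw [hf, coeff_zero]
  rw [coeff_derivative] at h1
  rcases mul_eq_zero.1 h1 with h | h
  · have : f.leadingCoeff = 0 := by rw [leadingCoeff, hm]; exact h
    rw [leadingCoeff_eq_zero] at this
    simp [this] at h0
  · have h2 : ((m + 1 : ℕ) : ZMod p) = 0 := by exact_mod_cast h
    rw [ZMod.natCast_eq_zero_iff] at h2
    have := Nat.le_of_dvd (Nat.succ_pos _) h2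
    omega

theorem sum_lineMult_of_irreducible (hA : A.Monic) (hirr : Irreducible A)
    (hAw : WtLE d (d * A.natDegree) A) (hr : r < p) (hd : (A.natDegree + 1) * d + r ≤ p) :
    A = X - C X ∨ (∃ x₀, A = X - C (C x₀)) ∨ ∑ x, lineMult A x + r < A.natDegree * p := by
  by_cases h1 : A = X - C X
  · exact Or.inl h1
  by_cases h2 : ∃ x₀, A = X - C (C x₀)
  · exact Or.inr (Or.inl h2)
  refine Or.inr (Or.inr ?_)
  set a := A.natDegree with ha
  have ha0 : 0 < a := by
    refine Nat.pos_of_ne_zero fun h => hirr.not_isUnit ?_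
    rw [hA.natDegree_eq_zero.1 h]
    exact isUnit_one
  have hlin : ∀ c : (ZMod p)[X], A ∣ X - C c → A = X - C c := fun c h =>
    eq_of_monic_of_associated hA (monic_X_sub_C c)
      (hirr.associated_of_dvd (irreducible_X_sub_C c) h)
  have heval : ∀ x : ZMod p, A.eval (C x) ≠ 0 := by
    intro x hx
    refine h2 ⟨x, ?_⟩
    have hdvd : X - C (C x) ∣ A := dvd_iff_isRoot.2 hx
    exact (eq_of_monic_of_associated (monic_X_sub_C (C x)) hA
      ((irreducible_X_sub_C (C x)).associated_of_dvd hirr hdvd)).symm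
  have hmult : ∀ x, lineMult A x = (A.eval (C x)).rootMultiplicity x := fun x => by
    rw [lineMult, if_neg (heval x)]
  by_cases h3 : innerDeriv A = 0
  · have hz : ∀ x, lineMult A x = 0 := by
      intro x
      have hder : derivative (A.eval (C x)) = 0 := by rw [← eval_innerDeriv, h3, eval_zero]
      have hdeg : (A.eval (C x)).natDegree ≤ d * a :=
        WtLE.natDegree_eval_le (d := d) (by exact_mod_cast hAw) x
      have hdlt : d * a < p := by
        rcases Nat.eq_zero_or_pos d with h | h
        · rw [h]; omega
        · nlinarith
      rw [hmult, eq_C_of_natDegree_eq_zero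
        (natDegree_eq_zero_of_derivative_eq_zero_of_lt hder (hdeg.trans_lt hdlt)),
        rootMultiplicity_C]
    rw [sum_congr rfl fun x _ => hz x]
    simp only [sum_const_zero, zero_add]
    nlinarith
  have hprime : Prime A := hirr.prime
  have hndvd : ¬ A ∣ (X - C X) * innerDeriv A := by
    intro h
    rcases hprime.dvd_or_dvd h with h | h
    · exact h1 (hlin _ h)
    · exact h3 (eq_zero_of_dvd_of_degree_lt h (degree_innerDeriv_lt hA))
  have hd0 : 0 < d := by
    by_contra hd0
    obtain rfl : d = 0 := by omega
    refine h3 ?_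
    ext j i
    rw [coeff_innerDeriv, coeff_derivative, hAw _ _ (by push_cast; simp), zero_mul]
    simp
  have hBw : WtLE d (d + (d * a - 1)) ((X - C X) * innerDeriv A) :=
    (wtLE_X.sub (wtLE_C (by rw [natDegree_X]; exact_mod_cast hd0))).mul hAw.innerDeriv
  obtain ⟨u, v, D, hD0, hDdeg, hD⟩ := exists_C_eq_mul_add_mul hA hprime hAw hBw hndvd
  have hdvd : ∏ x : ZMod p, (X - C x) ^ lineMult A x ∣ D := by
    refine Finset.prod_dvd_of_coprime ?_ ?_
    · intro x _ y _ hxy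
      exact (pairwise_coprime_X_sub_C Function.injective_id hxy).pow
    · intro x _
      have hDx : D = u.eval (C x) * A.eval (C x) +
          v.eval (C x) * ((C x - X) * derivative (A.eval (C x))) := by
        have := congrArg (eval (C x)) hD
        simpa [eval_innerDeriv] using this
      have hk : (X - C x) ^ lineMult A x ∣ A.eval (C x) := by
        rw [hmult]; exact pow_rootMultiplicity_dvd _ _
      rw [hDx]
      refine dvd_add (hk.mul_left _) (Dvd.dvd.mul_left ?_ _)
      rcases Nat.eq_zero_or_pos (lineMult A x) with h0 | h0
      · rw [h0, pow_zero]; exact one_dvd _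
      obtain ⟨k, hk'⟩ := Nat.exists_eq_succ_of_ne_zero h0.ne'
      rw [hk'] at hk ⊢
      have := pow_sub_one_dvd_derivative_of_pow_dvd hk
      obtain ⟨q, hq⟩ := this
      refine ⟨-q, ?_⟩
      rw [hq, Nat.succ_sub_one, pow_succ]
      ring
  have hle := natDegree_le_of_dvd hdvd hD0
  rw [natDegree_prod_of_monic _ _ fun x _ => (monic_X_sub_C x).pow _] at hle
  simp only [natDegree_pow, natDegree_X_sub_C, mul_one] at hle
  zify at hle hd ha0 ⊢
  have hr0 : (0 : ℤ) ≤ r := by positivity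
  rw [← ha] at hDdeg
  nlinarith

theorem sum_lineMult_le_and (hr : r < p) (hd : (n + 1) * d + r ≤ p) (hA : A.Monic)
    (hAw : WtLE d (d * A.natDegree) A) (hAn : A.natDegree ≤ n) :
    ∑ x, lineMult A x ≤ A.natDegree * p ∧ (A.natDegree * p ≤ ∑ x, lineMult A x + r →
      ∃ (α : ℕ) (M : Multiset (ZMod p)),
        A = (X - C X) ^ α * (M.map fun x => X - C (C x)).prod) := by
  induction hk : A.natDegree using Nat.strong_induction_on generalizing A with
  | _ a ih =>
  subst hk
  by_cases hA1 : A = 1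
  · refine ⟨?_, fun _ => ⟨0, 0, by simp [hA1]⟩⟩
    rw [hA1]
    simp [lineMult, rootMultiplicity_eq_zero]
  by_cases hirr : Irreducible A
  · have hdA : (A.natDegree + 1) * d + r ≤ p :=
      (Nat.add_le_add_right (Nat.mul_le_mul_right d (by omega)) r).trans hd
    rcases sum_lineMult_of_irreducible hA hirr hAw hr hdA with h | ⟨x₀, h⟩ | h
    · refine ⟨?_, fun _ => ⟨1, 0, by simp [h]⟩⟩
      rw [h]
      simp [lineMult_X_sub_C_X, ZMod.card]
    · refine ⟨?_, fun _ => ⟨0, {x₀}, by simp [h]⟩⟩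
      rw [h]
      simp [lineMult_X_sub_C_C]
    · exact ⟨by omega, fun h' => by omega⟩
  rw [hA.irreducible_iff_natDegree] at hirr
  push Not at hirr
  obtain ⟨f, g, hf, hg, hfg, hf0, hg0⟩ := hirr hA1
  have hdeg : A.natDegree = f.natDegree + g.natDegree := by rw [← hfg, hf.natDegree_mul hg]
  have hfw : WtLE d (d * f.natDegree) f := by
    have := WtLE.of_mul (i := 0) (j := g.natDegree) (hfg ▸ hAw) (by simp [hg.coeff_natDegree])
    exact this.mono (by rw [hf.natDegree_mul hg]; push_cast; linarith)
  have hgw : WtLE d (d * g.natDegree) g := by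
    have := WtLE.of_mul (i := 0) (j := f.natDegree) (P := g) (Q := f) (mul_comm f g ▸ hfg ▸ hAw)
      (by simp [hf.coeff_natDegree])
    exact this.mono (by rw [hg.natDegree_mul hf]; push_cast; linarith)
  obtain ⟨f1, f2⟩ := ih f.natDegree (by omega) hf hfw (by omega) rfl
  obtain ⟨g1, g2⟩ := ih g.natDegree (by omega) hg hgw (by omega) rfl
  have hsum : ∑ x, lineMult A x ≤ ∑ x, lineMult f x + ∑ x, lineMult g x := by
    rw [← sum_add_distrib, ← hfg]
    exact sum_le_sum fun x _ => lineMult_mul_le f g x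
  rw [hdeg, add_mul]
  refine ⟨by omega, fun h => ?_⟩
  obtain ⟨α, M, hfe⟩ := f2 (by omega)
  obtain ⟨β, N, hge⟩ := g2 (by omega)
  refine ⟨α + β, M + N, ?_⟩
  rw [Multiset.map_add, Multiset.prod_add, ← hfg]
  conv_lhs => rw [hfe, hge]
  ring

end LineMultiplicity

section DivisionByPencil
variable {R : Type*} [CommRing R] {t : R} {M H : R[X]} {m : ℕ}

theorem mem_span_pair_pow_succ {S : Type*} [CommRing S] {f g h : S} {m : ℕ}
    (hh : h ∈ Ideal.span {f, g} ^ (m + 1)) :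
    ∃ h₁ ∈ Ideal.span {f, g} ^ m, ∃ h₂, h = f * h₁ + g ^ (m + 1) * h₂ := by
  induction m generalizing h with
  | zero =>
    rw [zero_add, pow_one, Ideal.mem_span_pair] at hh
    obtain ⟨a, b, rfl⟩ := hh
    exact ⟨a, by simp, b, by ring⟩
  | succ m ih =>
    rw [pow_succ'] at hh
    refine Submodule.mul_induction_on hh ?_ ?_
    · intro u hu v hv
      rw [Ideal.mem_span_pair] at hu
      obtain ⟨a, b, rfl⟩ := hu
      obtain ⟨v₁, hv₁, v₂, rfl⟩ := ih hv
      refine ⟨a * (f * v₁ + g ^ (m + 1) * v₂) + b * g * v₁,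
        add_mem (Ideal.mul_mem_left _ _ hv) ?_, b * v₂, by ring⟩
      rw [pow_succ', mul_comm b g, mul_assoc]
      exact Ideal.mul_mem_mul (Ideal.subset_span (by simp)) (Ideal.mul_mem_left _ _ hv₁)
    · rintro _ _ ⟨u₁, hu₁, u₂, rfl⟩ ⟨v₁, hv₁, v₂, rfl⟩
      exact ⟨u₁ + v₁, add_mem hu₁ hv₁, u₂ + v₂, by ring⟩

theorem modByMonic_dvd_and_divByMonic_mem (hM : M.Monic)
    (hH : H ∈ Ideal.span {M, C t} ^ (m + 1)) :
    C t ^ (m + 1) ∣ H %ₘ M ∧ H /ₘ M ∈ Ideal.span {M, C t} ^ m := by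
  nontriviality R
  obtain ⟨h₁, hh₁, h₂, rfl⟩ := mem_span_pair_pow_succ hH
  obtain ⟨e₁, e₂⟩ := div_modByMonic_unique (f := M * h₁ + C t ^ (m + 1) * h₂)
    (h₁ + C t ^ (m + 1) * (h₂ /ₘ M)) (C (t ^ (m + 1)) * (h₂ %ₘ M)) hM
    ⟨by rw [C_pow]; linear_combination C t ^ (m + 1) * modByMonic_add_div h₂ M, by
      rw [C_mul']
      exact (degree_smul_le _ _).trans_lt (degree_modByMonic_lt _ hM)⟩
  rw [e₁, e₂, C_pow]
  refine ⟨dvd_mul_right _ _, add_mem hh₁ (Ideal.mul_mem_right _ _ ?_)⟩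
  exact Ideal.pow_le_pow_right (Nat.le_succ m)
    (Ideal.pow_mem_pow (Ideal.subset_span (by simp)) _)

end DivisionByPencil

section Descent
variable {p : ℕ} [Fact p.Prime] {d n : ℕ}

theorem monic_X_pow_sub_X {R : Type*} [CommRing R] [Nontrivial R] :
    (X ^ p - X : R[X]).Monic ∧ (X ^ p - X : R[X]).natDegree = p := by
  have hp : 1 < p := (Fact.out : p.Prime).one_lt
  have hdeg : (X : R[X]).degree < (p : WithBot ℕ) := by
    rw [degree_X]; exact_mod_cast hp
  refine ⟨monic_X_pow_sub (by simpa using hdeg), ?_⟩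
  have : (X : R[X]).degree < (X ^ p : R[X]).degree := by rwa [degree_X_pow]
  rw [natDegree_eq_of_degree_eq_some]
  rw [degree_sub_eq_left_of_degree_lt this, degree_X_pow]

theorem wtLE_X_pow_sub_X : WtLE 1 p (X ^ p - X : (ZMod p)[X][X]) := by
  have hp : 1 < p := (Fact.out : p.Prime).one_lt
  have := WtLE.prod (d := 1) (range p) (fun _ => (X : (ZMod p)[X][X])) 1 fun _ _ => by
    simpa using wtLE_X (K := ZMod p) (d := 1)
  simp only [prod_const, card_range, mul_one] at this
  exact this.sub (wtLE_X.mono (by exact_mod_cast hp.le))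

/-- A polynomial of total degree at most `n p` that vanishes to order `n` at all points `(x, y)`
with `y` in a set of size `p - d` is, on the line `Y = 0`, given by a form of degree `n` in `X ^ p`
with coefficients of low degree. -/
theorem exists_eval_X_pow_eq (hd : 1 ≤ d) (Y : Finset (ZMod p)) (hY : Y.card + d = p)
    (H : (ZMod p)[X][X]) (hH : H.Monic) (hdeg : H.natDegree = n * p) (hw : WtLE 1 (n * p) H)
    (hmem : ∀ y ∈ Y, H ∈ Ideal.span {X ^ p - X, C (X - C y)} ^ n) :
    ∃ G : (ZMod p)[X][X], G.Monic ∧ G.natDegree = n ∧ WtLE d (d * n) G ∧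
      G.eval (X ^ p) = H.map (evalRingHom 0) := by
  induction n generalizing H with
  | zero =>
    rw [zero_mul] at hdeg
    rw [hH.natDegree_eq_zero.1 hdeg]
    refine ⟨1, monic_one, natDegree_one, ?_, by simp⟩
    simpa using wtLE_C (K := ZMod p) (d := d) (w := 0) (a := 1) (by simp)
  | succ n ih =>
    obtain ⟨hM, hMdeg⟩ := monic_X_pow_sub_X (p := p) (R := (ZMod p)[X])
    set M : (ZMod p)[X][X] := X ^ p - X with hMdef
    have hMw : WtLE 1 ((1 : ℕ) * M.natDegree : ℤ) M := by
      rw [hMdeg]; simpa using wtLE_X_pow_sub_X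
    obtain ⟨hQw, hcw⟩ := WtLE.exists_div hM hMw hw
    have hle : M.natDegree ≤ H.natDegree := by
      rw [hMdeg, hdeg]; exact Nat.le_mul_of_pos_left p n.succ_pos
    have hQ : (H /ₘ M).Monic := by
      rw [Monic, leadingCoeff_divByMonic_of_monic hM, hH.leadingCoeff]
      rw [degree_eq_natDegree hM.ne_zero, degree_eq_natDegree hH.ne_zero]
      exact_mod_cast hle
    have hQdeg : (H /ₘ M).natDegree = n * p := by
      rw [natDegree_divByMonic _ hM, hdeg, hMdeg, Nat.succ_mul, Nat.add_sub_cancel]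
    obtain ⟨G, hG, hGdeg, hGw, hGe⟩ := ih (H /ₘ M) hQ hQdeg
      (hQw.mono (by rw [hMdeg]; push_cast; linarith))
      fun y hy => (modByMonic_dvd_and_divByMonic_mem hM (hmem y hy)).2
    set N : (ZMod p)[X] := ∏ y ∈ Y, (X - C y) ^ (n + 1) with hN
    have hNmonic : N.Monic := monic_prod_of_monic _ _ fun y _ => (monic_X_sub_C y).pow _
    have hNdeg : N.natDegree = Y.card * (n + 1) := by
      rw [hN, natDegree_prod_of_monic _ _ fun y _ => (monic_X_sub_C y).pow _]
      simp
    have hdvd : C N ∣ H %ₘ M := by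
      rw [hN, map_prod]
      refine Finset.prod_dvd_of_coprime ?_ ?_
      · intro x _ y _ hxy
        exact ((pairwise_coprime_X_sub_C Function.injective_id hxy).pow).map C
      · intro y hy
        rw [C_pow]
        exact (modByMonic_dvd_and_divByMonic_mem hM (hmem y hy)).1
    obtain ⟨c, hc⟩ := hdvd
    have hcw' : WtLE 1 ((d * (n + 1) : ℕ) : ℤ) c := by
      have h1 : WtLE 1 _ (c * C N) := (by rw [mul_comm, ← hc]; exact hcw)
      have h2 := h1.of_mul (i := N.natDegree) (j := 0) (by simp [hNmonic.coeff_natDegree])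
      refine h2.mono ?_
      have : (Y.card : ℤ) + d = p := by exact_mod_cast hY
      rw [hNdeg, ← this]
      push_cast
      linarith
    set c₀ : (ZMod p)[X] := (H %ₘ M).map (evalRingHom 0) with hc₀
    have hc₀deg : c₀.natDegree ≤ d * (n + 1) := by
      rw [hc₀, hc, Polynomial.map_mul, map_C]
      refine (natDegree_C_mul_le _ _).trans ?_
      rw [natDegree_le_iff_coeff_eq_zero]
      intro j hj
      rw [coeff_map, coe_evalRingHom, ← coeff_zero_eq_eval_zero]
      exact hcw' 0 j (by push_cast; exact_mod_cast (by simpa using hj))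
    have hXG : ((X - C X) * G).Monic := (monic_X_sub_C X).mul hG
    have hXGdeg : ((X - C X) * G).natDegree = n + 1 := by
      rw [(monic_X_sub_C X).natDegree_mul hG, natDegree_X_sub_C, hGdeg, add_comm]
    have hlt : (C c₀ : (ZMod p)[X][X]).degree < ((X - C X) * G).degree := by
      refine degree_C_le.trans_lt ?_
      rw [degree_eq_natDegree hXG.ne_zero, hXGdeg]
      exact_mod_cast n.succ_pos
    refine ⟨(X - C X) * G + C c₀, hXG.add_of_left hlt, ?_, ?_, ?_⟩
    · rw [natDegree_add_eq_left_of_degree_lt hlt, hXGdeg]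
    · have h1 : WtLE d d (X - C X : (ZMod p)[X][X]) :=
        wtLE_X.sub (wtLE_C (by rw [natDegree_X]; exact_mod_cast hd))
      refine ((h1.mul hGw).mono (by push_cast; linarith)).add (wtLE_C ?_)
      exact_mod_cast hc₀deg
    · have := congrArg (Polynomial.map (evalRingHom (0 : ZMod p))) (modByMonic_add_div H M)
      rw [← this, hc₀]
      simp only [eval_add, eval_mul, eval_sub, eval_X, eval_C, hGe, Polynomial.map_add,
        Polynomial.map_mul, hMdef, Polynomial.map_sub, Polynomial.map_pow, map_X]
      ring

end Descent

section Redei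
variable {p : ℕ} [Fact p.Prime] {d n r : ℕ} {ι : Type*}

theorem prod_X_sub_C_eq_X_pow_sub_X :
    ∏ x : ZMod p, (X - C x) = (X ^ p - X : (ZMod p)[X]) := by
  have hroots := FiniteField.roots_X_pow_card_sub_X (ZMod p)
  rw [ZMod.card] at hroots
  obtain ⟨hM, hdeg⟩ := monic_X_pow_sub_X (p := p) (R := ZMod p)
  have := prod_multiset_X_sub_C_of_monic_of_roots_card_eq hM (by
    rw [hroots, hdeg]; simp [ZMod.card])
  rw [hroots] at this
  exact this

theorem C_X_sub_C_dvd {K : Type*} [Field K] {y : K} {P : K[X][X]}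
    (h : P.map (evalRingHom y) = 0) : C (X - C y) ∣ P := by
  rw [C_dvd_iff_dvd_coeff]
  intro i
  rw [dvd_iff_isRoot]
  have := congrArg (fun Q => Q.coeff i) h
  simpa [coeff_map] using this

theorem span_X_sub_C_pairwise_isCoprime (y : ZMod p) (s : Set (ZMod p)) :
    s.Pairwise (Function.onFun IsCoprime
      fun x => Ideal.span {(X - C (C x) : (ZMod p)[X][X]), C (X - C y)}) := by
  intro x _ x' _ hxx
  have h1 : IsCoprime (X - C (C x) : (ZMod p)[X][X]) (X - C (C x')) := by
    have := (pairwise_coprime_X_sub_C Function.injective_id hxx).map (mapRingHom (C : ZMod p →+* _))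
    simpa using this
  rw [Function.onFun, Ideal.isCoprime_iff_exists]
  obtain ⟨u, v, huv⟩ := h1
  exact ⟨_, Ideal.mul_mem_left _ u (Ideal.subset_span (by simp)),
    _, Ideal.mul_mem_left _ v (Ideal.subset_span (by simp)), huv⟩

theorem prod_span_pair_le {R κ : Type*} [CommRing R] (s : Finset κ) (l : κ → R) (t : R) :
    ∏ x ∈ s, Ideal.span {l x, t} ≤ Ideal.span {∏ x ∈ s, l x, t} := by
  induction s using Finset.induction_on with
  | empty =>
    rw [prod_empty, prod_empty]
    refine fun z _ => ?_
    rw [Ideal.mem_span_pair]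
    exact ⟨z, 0, by ring⟩
  | insert a s ha ih =>
    rw [prod_insert ha, prod_insert ha]
    refine (Ideal.mul_mono_right ih).trans (Ideal.mul_le.2 fun u hu v hv => ?_)
    rw [Ideal.mem_span_pair] at *
    obtain ⟨u₁, u₂, rfl⟩ := hu
    obtain ⟨v₁, v₂, rfl⟩ := hv
    exact ⟨u₁ * v₁, u₁ * l a * v₂ + u₂ * v₁ * ∏ x ∈ s, l x + u₂ * v₂ * t, by ring⟩

variable (U : Finset ι) (a b : ι → ZMod p)

/-- The Rédei polynomial `∏ (X - b u - a u Y)` of a finite family of points. -/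
noncomputable def redei : (ZMod p)[X][X] := ∏ u ∈ U, (X - C (C (b u) + C (a u) * X))

/-- The quotient of `X ^ (n p)` by the Rédei polynomial. -/
noncomputable def redeiCofactor (n : ℕ) : (ZMod p)[X][X] := X ^ (n * p) /ₘ redei U a b

/-- The number of points on the line with parameters `x` and `y`. -/
noncomputable def fiberCard (y x : ZMod p) : ℕ := (U.filter fun u => b u + a u * y = x).card

theorem redei_monic : (redei U a b).Monic := monic_prod_of_monic _ _ fun _ _ => monic_X_sub_C _

theorem natDegree_redei : (redei U a b).natDegree = U.card := by
  rw [redei, natDegree_prod_of_monic _ _ fun u _ => monic_X_sub_C _]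
  simp only [natDegree_X_sub_C, sum_const, smul_eq_mul, mul_one]

theorem wtLE_redei : WtLE 1 U.card (redei U a b) := by
  have := WtLE.prod (d := 1) U (fun u => X - C (C (b u) + C (a u) * X)) 1 fun u _ => by
    refine WtLE.sub (by simpa using wtLE_X (K := ZMod p) (d := 1)) (wtLE_C ?_)
    have : (C (b u) + C (a u) * X : (ZMod p)[X]).natDegree ≤ 1 := by compute_degree
    exact_mod_cast this
  rw [mul_one] at this
  exact this

theorem redei_map_eval (y : ZMod p) :
    (redei U a b).map (evalRingHom y) = ∏ x, (X - C x) ^ fiberCard U a b y x := by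
  rw [redei, Polynomial.map_prod, ← prod_fiberwise U fun u => b u + a u * y]
  refine prod_congr rfl fun x _ => ?_
  rw [fiberCard, ← prod_const]
  refine prod_congr rfl fun u hu => ?_
  rw [← (mem_filter.1 hu).2]
  simp

variable {U a b}

theorem redeiCofactor_monic (hU : U.card + r = n * p) :
    (redeiCofactor U a b n).Monic ∧ (redeiCofactor U a b n).natDegree = r ∧
      WtLE 1 r (redeiCofactor U a b n) := by
  have hR := redei_monic U a b
  have hRdeg := natDegree_redei U a b
  refine ⟨?_, ?_, ?_⟩
  · rw [Monic, redeiCofactor, leadingCoeff_divByMonic_of_monic hR, (monic_X_pow _).leadingCoeff]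
    rw [degree_eq_natDegree hR.ne_zero, hRdeg, degree_X_pow]
    exact_mod_cast (by omega)
  · rw [redeiCofactor, natDegree_divByMonic _ hR, natDegree_X_pow, hRdeg]
    omega
  · have hX := WtLE.prod (d := 1) (range (n * p)) (fun _ => (X : (ZMod p)[X][X])) 1 fun _ _ => by
      simpa using wtLE_X (K := ZMod p) (d := 1)
    simp only [prod_const, card_range, mul_one] at hX
    have hRw : WtLE 1 ((1 : ℕ) * (redei U a b).natDegree : ℤ) (redei U a b) := by
      rw [hRdeg]; simpa using wtLE_redei U a b
    refine (WtLE.exists_div hR hRw hX).1.mono ?_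
    rw [hRdeg, ← hU]
    push_cast
    linarith

theorem redeiCofactor_map_eval (hU : U.card + r = n * p) (hr : r + 1 < p) {y : ZMod p}
    (hy : ∀ x, fiberCard U a b y x ≤ n) :
    (redeiCofactor U a b n).map (evalRingHom y) = ∏ x, (X - C x) ^ (n - fiberCard U a b y x) := by
  have hmul : (redei U a b).map (evalRingHom y) * ∏ x, (X - C x) ^ (n - fiberCard U a b y x) =
      (X ^ p - X) ^ n := by
    rw [redei_map_eval, ← prod_mul_distrib, ← prod_X_sub_C_eq_X_pow_sub_X, ← prod_pow]
    refine prod_congr rfl fun x _ => ?_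
    rw [← pow_add, Nat.add_sub_cancel' (hy x)]
  have hR := (redei_monic U a b).map (evalRingHom y)
  rw [redeiCofactor, map_divByMonic _ (redei_monic U a b)]
  refine (div_modByMonic_unique _ (X ^ (n * p) - (X ^ p - X) ^ n) hR ⟨?_, ?_⟩).1
  · rw [hmul]; simp
  rw [degree_eq_natDegree hR.ne_zero, (redei_monic U a b).natDegree_map, natDegree_redei]
  rcases Nat.eq_zero_or_pos n with rfl | hn
  · simp
  have hgeom : (X ^ (n * p) - (X ^ p - X) ^ n : (ZMod p)[X]) =
      (∑ i ∈ range n, (X ^ p) ^ i * (X ^ p - X) ^ (n - 1 - i)) * X := by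
    have := geom_sum₂_mul (X ^ p : (ZMod p)[X]) (X ^ p - X) n
    rw [sub_sub_cancel, ← pow_mul, mul_comm p n] at this
    exact this.symm
  rw [hgeom]
  refine (degree_le_of_natDegree_le (n := (n - 1) * p + 1) ?_).trans_lt ?_
  · refine natDegree_mul_le.trans (Nat.add_le_add ?_ natDegree_X.le)
    refine natDegree_sum_le_of_forall_le _ _ fun i hi => natDegree_mul_le.trans ?_
    rw [← pow_mul, natDegree_X_pow]
    have h2 : ((X ^ p - X : (ZMod p)[X]) ^ (n - 1 - i)).natDegree ≤ (n - 1 - i) * p := by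
      refine natDegree_pow_le.trans ?_
      rw [(monic_X_pow_sub_X (R := ZMod p)).2]
    refine (Nat.add_le_add_left h2 _).trans ?_
    rw [mul_comm p i, ← add_mul]
    exact Nat.mul_le_mul_right p (by have := mem_range.1 hi; omega)
  · obtain ⟨m, rfl⟩ := Nat.exists_eq_succ_of_ne_zero hn.ne'
    rw [Nat.succ_mul] at hU
    rw [Nat.succ_sub_one]
    exact_mod_cast (by omega)

theorem redei_mul_redeiCofactor_mem (hU : U.card + r = n * p) (hr : r + 1 < p) {y : ZMod p}
    (hy : ∀ x, fiberCard U a b y x ≤ n ∧ n ≤ fiberCard U a b y x + 1) :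
    redei U a b * redeiCofactor U a b n ∈
      Ideal.span {(X ^ p - X : (ZMod p)[X][X]), C (X - C y)} ^ n := by
  set J : ZMod p → Ideal (ZMod p)[X][X] :=
    fun x => Ideal.span {(X - C (C x) : (ZMod p)[X][X]), C (X - C y)} with hJ
  have hJt : ∀ x, C (X - C y) ∈ J x := fun x => Ideal.subset_span (by simp)
  have hJX : ∀ x, X - C (C x) ∈ J x := fun x => Ideal.subset_span (by simp)
  have hR : redei U a b ∈ ∏ x, J x ^ fiberCard U a b y x := by
    have h1 : ∏ x, J x ^ fiberCard U a b y x = ∏ u ∈ U, J (b u + a u * y) := by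
      rw [← prod_fiberwise' U (fun u => b u + a u * y)]
      exact prod_congr rfl fun x _ => by rw [fiberCard, prod_const]
    rw [h1]
    refine Ideal.prod_mem_prod fun u _ => ?_
    have h2 : (X - C (C (b u) + C (a u) * X) : (ZMod p)[X][X]) =
        (X - C (C (b u + a u * y))) - C (C (a u)) * C (X - C y) := by
      simp only [map_add, map_mul, map_sub]
      ring
    rw [h2]
    exact sub_mem (hJX _) (Ideal.mul_mem_left _ _ (hJt _))
  have hf : redeiCofactor U a b n ∈ ∏ x, J x ^ (n - fiberCard U a b y x) := by
    have h1 : (∏ x, (X - C (C x)) ^ (n - fiberCard U a b y x) : (ZMod p)[X][X]) ∈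
        ∏ x, J x ^ (n - fiberCard U a b y x) :=
      Ideal.prod_mem_prod fun x _ => Ideal.pow_mem_pow (hJX x) _
    have h2 : C (X - C y) ∈ ∏ x, J x ^ (n - fiberCard U a b y x) := by
      rw [Ideal.prod_eq_iInf_of_pairwise_isCoprime]
      · simp only [Ideal.mem_iInf]
        intro x _
        have : n - fiberCard U a b y x = 0 ∨ n - fiberCard U a b y x = 1 := by
          have := hy x; omega
        rcases this with h | h <;> rw [h]
        · simp
        · exact (pow_one (J x)).symm ▸ hJt x
      · intro x hx x' hx' hne
        exact (span_X_sub_C_pairwise_isCoprime y _ hx hx' hne).pow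
    have h3 : C (X - C y) ∣ redeiCofactor U a b n -
        ∏ x, (X - C (C x)) ^ (n - fiberCard U a b y x) := by
      refine C_X_sub_C_dvd ?_
      rw [Polynomial.map_sub, redeiCofactor_map_eval hU hr fun x => (hy x).1, Polynomial.map_prod,
        sub_eq_zero]
      refine prod_congr rfl fun x _ => ?_
      simp
    obtain ⟨q, hq⟩ := h3
    rw [sub_eq_iff_eq_add] at hq
    rw [hq]
    exact add_mem (Ideal.mul_mem_right _ _ h2) h1
  have hmem := Ideal.mul_mem_mul hR hf
  rw [← prod_mul_distrib] at hmem
  have hpow : ∀ x ∈ (univ : Finset (ZMod p)),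
      J x ^ fiberCard U a b y x * J x ^ (n - fiberCard U a b y x) = J x ^ n := fun x _ =>
    (pow_add (J x) _ _).symm.trans (congrArg (J x ^ ·) (Nat.add_sub_cancel' (hy x).1))
  rw [prod_congr rfl hpow, prod_pow] at hmem
  refine Ideal.pow_right_mono ?_ n hmem
  have hprod : (∏ x : ZMod p, (X - C (C x)) : (ZMod p)[X][X]) = X ^ p - X := by
    have := congrArg (Polynomial.map (C : ZMod p →+* (ZMod p)[X]))
      (prod_X_sub_C_eq_X_pow_sub_X (p := p))
    simpa [Polynomial.map_prod] using this
  rw [← hprod]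
  exact prod_span_pair_le _ _ _

/-- Fibres of the projection `Y = 0` are controlled by those of the lines in directions which are
neither rich nor poor. -/
theorem exists_card_add_le_and_fiberCard_le (hU : U.card + r = n * p) (hr : r + 1 < p)
    (hd : 1 ≤ d) (hdn : (n + 1) * d + r ≤ p) (Y : Finset (ZMod p)) (hY : Y.card + d = p)
    (hfib : ∀ y ∈ Y, ∀ x, fiberCard U a b y x ≤ n ∧ n ≤ fiberCard U a b y x + 1)
    (hfp : ∀ x, fiberCard U a b 0 x ≤ p) :
    ∃ (α : ℕ) (s : Finset (ZMod p)), s.card + α ≤ n ∧ ∀ x ∉ s, fiberCard U a b 0 x ≤ α := by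
  obtain ⟨hf, hfdeg, hfw⟩ := redeiCofactor_monic (a := a) (b := b) hU
  have hR := redei_monic U a b
  obtain ⟨G, hG, hGdeg, hGw, hGe⟩ := exists_eval_X_pow_eq hd Y hY (n := n)
    (redei U a b * redeiCofactor U a b n) (hR.mul hf)
    (by rw [hR.natDegree_mul hf, hfdeg, natDegree_redei, hU])
    (((wtLE_redei U a b).mul hfw).mono (by exact_mod_cast hU.le))
    fun y hy => redei_mul_redeiCofactor_mem hU hr (hfib y hy)
  have hmult : ∀ x, fiberCard U a b 0 x ≤ lineMult G x := by
    intro x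
    have h1 : (X - C x) ^ fiberCard U a b 0 x ∣ G.eval (X ^ p) := by
      rw [hGe, Polynomial.map_mul, redei_map_eval]
      exact (dvd_prod_of_mem (fun x => (X - C x) ^ fiberCard U a b 0 x) (mem_univ x)).mul_right _
    have h2 : (X - C x) ^ fiberCard U a b 0 x ∣ G.eval (X ^ p) - G.eval (C x) := by
      refine dvd_trans ?_ (sub_dvd_eval_sub _ _ G)
      have : (X ^ p - C x : (ZMod p)[X]) = (X - C x) ^ p := by
        rw [sub_pow_char, ← C_pow, ZMod.pow_card]
      rw [this]
      exact pow_dvd_pow _ (hfp x)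
    have h3 := (dvd_sub_right h1).1 h2
    rw [lineMult]
    split_ifs with h0
    · exact hfp x
    · exact (le_rootMultiplicity_iff h0).2 h3
  have hsum : ∑ x, fiberCard U a b 0 x = U.card :=
    (card_eq_sum_card_fiberwise (f := fun u => b u + a u * 0) (t := univ) fun _ _ =>
      mem_coe.2 (mem_univ _)).symm
  obtain ⟨α, M, hGM⟩ := (sum_lineMult_le_and (n := n) (d := d) (r := r) (A := G) (by omega) hdn hG
    (by rw [hGdeg]; exact hGw) hGdeg.le).2 (by
      rw [hGdeg, ← hU, ← hsum]
      exact Nat.add_le_add_right (sum_le_sum fun x _ => hmult x) r)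
  have hMdeg : G.natDegree = α + Multiset.card M := by
    rw [hGM, ((monic_X_sub_C _).pow _).natDegree_mul
      (monic_multiset_prod_of_monic _ _ fun x _ => monic_X_sub_C _),
      (monic_X_sub_C _).natDegree_pow, natDegree_X_sub_C, mul_one,
      natDegree_multiset_prod_of_monic]
    · simp
    · intro f hf
      obtain ⟨x, _, rfl⟩ := Multiset.mem_map.1 hf
      exact monic_X_sub_C _
  refine ⟨α, M.toFinset, ?_, fun x hx => (hmult x).trans ?_⟩
  · have := Multiset.toFinset_card_le M
    omega
  have hpow : ∀ k : ℕ, lineMult ((X - C X : (ZMod p)[X][X]) ^ k) x ≤ k := by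
    intro k
    induction k with
    | zero => simp [lineMult, rootMultiplicity_eq_zero]
    | succ k ih =>
      rw [pow_succ]
      exact (lineMult_mul_le _ _ x).trans (Nat.add_le_add ih (lineMult_X_sub_C_X x).le)
  have hM0 : lineMult (M.map fun x => (X - C (C x) : (ZMod p)[X][X])).prod x = 0 := by
    rw [Multiset.mem_toFinset] at hx
    clear hGM hMdeg
    induction M using Multiset.induction_on with
    | empty => simp [lineMult, rootMultiplicity_eq_zero]
    | cons x₀ M ih =>
      rw [Multiset.mem_cons, not_or] at hx
      rw [Multiset.map_cons, Multiset.prod_cons]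
      refine Nat.le_zero.1 ((lineMult_mul_le _ _ x).trans ?_)
      rw [ih hx.2, lineMult_X_sub_C_C, if_neg hx.1]
  rw [hGM]
  refine (lineMult_mul_le _ _ x).trans ?_
  rw [hM0]
  exact hpow α

end Redei

section Counting
variable {p n r : ℕ} {U : Finset (ZMod p × ZMod p)}

theorem isRich_iff (hU : U.card + r = n * p) (hr : r < p) {l : Finset (ZMod p × ZMod p)} :
    IsRich p U l ↔ n + 1 ≤ (l ∩ U).card := by
  have hp : (0 : ℚ) < p := by exact_mod_cast (Nat.zero_le r).trans_lt hr
  have hU' : (U.card : ℚ) = n * p - r := by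
    rw [eq_sub_iff_add_eq]
    exact_mod_cast hU
  have hr' : (r : ℚ) < p := by exact_mod_cast hr
  have hr0 : (0 : ℚ) ≤ r := by positivity
  rw [IsRich, ← le_sub_iff_add_le, div_le_iff₀ hp, hU']
  constructor
  · intro h
    by_contra! hlt
    have h1 : ((l ∩ U).card : ℚ) - 1 ≤ n - 1 := by
      gcongr
      exact_mod_cast Nat.lt_succ_iff.1 hlt
    nlinarith
  · intro h
    have h1 : (n : ℚ) ≤ (l ∩ U).card - 1 := by
      rw [le_sub_iff_add_le]
      exact_mod_cast h
    nlinarith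

theorem le_card_add_one_of_not_isPoor (hU : U.card + r = n * p) (hr : r < p)
    {l : Finset (ZMod p × ZMod p)} (h : ¬ IsPoor p U l) : n ≤ (l ∩ U).card + 1 := by
  have hp : (0 : ℚ) < p := by exact_mod_cast (Nat.zero_le r).trans_lt hr
  have hU' : (U.card : ℚ) = n * p - r := by
    rw [eq_sub_iff_add_eq]
    exact_mod_cast hU
  have hr' : (r : ℚ) < p := by exact_mod_cast hr
  by_contra! hlt
  refine h ?_
  have h1 : ((l ∩ U).card : ℚ) + 1 + 1 ≤ n := by exact_mod_cast hlt
  rw [IsPoor, le_sub_iff_add_le, le_div_iff₀ hp, hU']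
  nlinarith

theorem structure_of_sum_eq {κ : Type*} [Fintype κ] {k : κ → ℕ} {α : ℕ} {s : Finset κ}
    (hκ : Fintype.card κ = p) (hk : ∑ x, k x + r = n * p) (hkp : ∀ x, k x ≤ p) (hr : r < p)
    (hs : s.card + α ≤ n) (hks : ∀ x ∉ s, k x ≤ α) (hrich : ∃ x, n < k x) :
    s.card + α = n ∧ 1 ≤ s.card ∧ (∀ x ∈ s, p + s.card * α ≤ k x + r) ∧ s.card * α ≤ r := by
  obtain ⟨x₀, hx₀⟩ := hrich
  have hx₀s : x₀ ∈ s := by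
    by_contra h
    have := hks x₀ h
    omega
  have hs1 : 1 ≤ s.card := card_pos.2 ⟨x₀, hx₀s⟩
  have hcompl : ∑ x ∈ sᶜ, k x ≤ (p - s.card) * α := by
    refine (sum_le_card_nsmul _ _ α fun x hx => hks x (mem_compl.1 hx)).trans ?_
    rw [card_compl, hκ, smul_eq_mul]
  have hsp : s.card ≤ p := hκ ▸ card_le_univ s
  have hsum : ∑ x ∈ s, k x ≤ s.card * p :=
    (sum_le_card_nsmul _ _ p fun x _ => hkp x).trans (by rw [smul_eq_mul])
  rw [← sum_add_sum_compl s] at hk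
  zify [hsp] at hk hcompl hsum hr hs hs1
  have heq : s.card + α = n := by
    by_contra hne
    have h1 : s.card + α + 1 ≤ n := by
      zify
      zify at hne
      omega
    zify at h1
    nlinarith
  refine ⟨heq, by exact_mod_cast hs1, fun x hx => ?_, ?_⟩
  · have h2 : ∑ z ∈ s.erase x, k z ≤ (s.card - 1) * p := by
      refine (sum_le_card_nsmul _ _ p fun x _ => hkp x).trans ?_
      rw [card_erase_of_mem hx, smul_eq_mul]
    have h3 : ((∑ z ∈ s.erase x, k z + k x : ℕ) : ℤ) = _ := congrArg _ (sum_erase_add s k hx)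
    have h4 : 1 ≤ s.card := by exact_mod_cast hs1
    zify [h4] at h2 ⊢
    push_cast at h3
    have h5 : (n : ℤ) = s.card + α := by exact_mod_cast heq.symm
    rw [h5] at hk
    nlinarith
  · zify
    have h5 : (n : ℤ) = s.card + α := by exact_mod_cast heq.symm
    rw [h5] at hk
    nlinarith

end Counting

section Directions
variable {p n r : ℕ} [Fact p.Prime]

/-- The linear form whose level sets are the lines with slope `m`. -/
noncomputable def slopeForm (m : Option (ZMod p)) (q : ZMod p × ZMod p) : ZMod p :=
  m.elim q.1 fun m => q.2 - m * q.1

theorem mem_lineWithSlope_iff {m : Option (ZMod p)} {c : ZMod p} {q : ZMod p × ZMod p} :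
    q ∈ lineWithSlope p m c ↔ slopeForm m q = c := by
  cases m <;> simp [lineWithSlope, slopeForm, sub_eq_iff_eq_add']

theorem eq_zero_of_slopeForm_add_eq_zero {m m' : Option (ZMod p)} (h : m ≠ m') {u v : ZMod p}
    (huv : ∀ q, u * slopeForm m q + v * slopeForm m' q = 0) : u = 0 ∧ v = 0 := by
  have h1 := huv (1, 0)
  have h2 := huv (0, 1)
  rcases m with _ | a <;> rcases m' with _ | b <;> simp [slopeForm] at h1 h2
  · exact absurd rfl h
  · subst h2; simpa using h1
  · subst h2; simpa using h1
  · obtain rfl := eq_neg_of_add_eq_zero_left h2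
    have : v * (a - b) = 0 := by linear_combination h1
    rcases mul_eq_zero.1 this with rfl | h3
    · simp
    · exact absurd (congrArg some (sub_eq_zero.1 h3)) h

theorem exists_eq_mul_slopeForm {A B : ZMod p} (h : A ≠ 0 ∨ B ≠ 0) :
    ∃ (m : Option (ZMod p)) (l : ZMod p), l ≠ 0 ∧
      ∀ q : ZMod p × ZMod p, A * q.1 + B * q.2 = l * slopeForm m q := by
  by_cases hB : B = 0
  · subst hB
    exact ⟨none, A, by simpa using h, fun q => by simp [slopeForm]⟩
  · refine ⟨some (-A / B), B, hB, fun q => ?_⟩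
    simp only [slopeForm, Option.elim]
    field_simp
    ring

theorem slopeForm_eq (m : Option (ZMod p)) (q : ZMod p × ZMod p) :
    slopeForm m q = slopeForm m (1, 0) * q.1 + slopeForm m (0, 1) * q.2 := by
  cases m <;> simp [slopeForm]
  ring

/-- The members of the pencil spanned by two linear forms have distinct slopes. -/
theorem exists_injective_slope {m m' : Option (ZMod p)} (h : m ≠ m') :
    ∃ f : ZMod p → Option (ZMod p), f.Injective ∧ (∀ y, f y ≠ m') ∧
      ∀ y, ∃ l : ZMod p, l ≠ 0 ∧
        ∀ q, slopeForm m q + slopeForm m' q * y = l * slopeForm (f y) q := by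
  have hex : ∀ y : ZMod p, ∃ (k : Option (ZMod p)) (l : ZMod p), l ≠ 0 ∧
      ∀ q, slopeForm m q + slopeForm m' q * y = l * slopeForm k q := by
    intro y
    obtain ⟨k, l, hl, hk⟩ := exists_eq_mul_slopeForm
      (A := slopeForm m (1, 0) + slopeForm m' (1, 0) * y)
      (B := slopeForm m (0, 1) + slopeForm m' (0, 1) * y) (by
        by_contra! h0
        refine one_ne_zero (eq_zero_of_slopeForm_add_eq_zero h (u := 1) (v := y) fun q => ?_).1
        rw [slopeForm_eq m q, slopeForm_eq m' q]
        linear_combination q.1 * h0.1 + q.2 * h0.2)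
    refine ⟨k, l, hl, fun q => ?_⟩
    rw [← hk, slopeForm_eq m q, slopeForm_eq m' q]
    ring
  choose f l hl hf using hex
  refine ⟨f, fun y y' hyy => ?_, fun y hy => ?_, fun y => ⟨l y, hl y, hf y⟩⟩
  · obtain ⟨h1, h2⟩ := eq_zero_of_slopeForm_add_eq_zero h (u := l y' - l y)
      (v := l y' * y - l y * y') fun q => by
        have h1 := hf y q
        have h2 := hf y' q
        rw [hyy] at h1
        linear_combination l y' * h1 - l y * h2
    rw [sub_eq_zero.1 h1, ← mul_sub] at h2
    exact sub_eq_zero.1 ((mul_eq_zero.1 h2).resolve_left (hl y))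
  · refine one_ne_zero (eq_zero_of_slopeForm_add_eq_zero h (u := 1) (v := y - l y) fun q => ?_).1
    have h1 := hf y q
    rw [hy] at h1
    linear_combination h1

variable {U : Finset (ZMod p × ZMod p)}

theorem card_lineWithSlope_le (m : Option (ZMod p)) (c : ZMod p) :
    (lineWithSlope p m c).card ≤ p := by
  obtain ⟨m', hm'⟩ := exists_ne m
  have : (lineWithSlope p m c).card ≤ (univ : Finset (ZMod p)).card := by
    refine card_le_card_of_injOn (slopeForm m') (fun _ _ => mem_coe.2 (mem_univ _)) ?_
    intro q hq q' hq' h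
    rw [mem_coe, mem_lineWithSlope_iff] at hq hq'
    have h1 := hq.trans hq'.symm
    rcases m with _ | a <;> rcases m' with _ | b
    · exact absurd rfl hm'
    all_goals simp only [slopeForm, Option.elim] at h h1
    · rw [h1] at h
      exact Prod.ext h1 (sub_left_inj.1 h)
    · rw [h] at h1
      exact Prod.ext h (sub_left_inj.1 h1)
    · have h2 : (a - b) * (q.1 - q'.1) = 0 := by linear_combination h - h1
      have h3 := sub_eq_zero.1 ((mul_eq_zero.1 h2).resolve_left
        fun h4 => hm' (congrArg some (sub_eq_zero.1 h4).symm))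
      rw [h3] at h1
      exact Prod.ext h3 (sub_left_inj.1 h1)
  rwa [card_univ, ZMod.card] at this

theorem sum_card_lineWithSlope_inter (m : Option (ZMod p)) :
    ∑ c, (lineWithSlope p m c ∩ U).card = U.card := by
  rw [card_eq_sum_card_fiberwise (f := slopeForm m) (t := univ) fun _ _ => mem_coe.2 (mem_univ _)]
  refine sum_congr rfl fun c _ => congrArg card ?_
  ext q
  rw [mem_inter, mem_filter, mem_lineWithSlope_iff, and_comm]

theorem fiberCard_eq_card_inter {m : Option (ZMod p)} {e g : ZMod p × ZMod p → ZMod p}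
    {y l : ZMod p} (hl : l ≠ 0) (h : ∀ q, g q + e q * y = l * slopeForm m q) (x : ZMod p) :
    fiberCard U e g y x = (lineWithSlope p m (x / l) ∩ U).card := by
  refine congrArg card ?_
  ext q
  rw [mem_inter, mem_filter, mem_lineWithSlope_iff, and_comm, h, eq_div_iff hl, mul_comm]

theorem exists_card_add_le_and_card_inter_le (hU : U.card + r = n * p) (hr : r + n < p)
    (hn : 1 ≤ n) (hD : ({m : Option (ZMod p) | IsSpecialDir p U m}.ncard : ℚ) ≤
      1 + ((p : ℚ) - r) / (n + 1)) (m : Option (ZMod p)) :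
    ∃ (α : ℕ) (s : Finset (ZMod p)), s.card + α ≤ n ∧
      ∀ x ∉ s, (lineWithSlope p m x ∩ U).card ≤ α := by
  set T : Finset (Option (ZMod p)) := univ.filter (IsSpecialDir p U) with hT
  have hTc : {m : Option (ZMod p) | IsSpecialDir p U m}.ncard = T.card := by
    rw [← Set.ncard_coe_finset]
    congr
    ext
    simp [hT]
  rw [hTc] at hD
  obtain ⟨m', hm', hT'⟩ : ∃ m', m ≠ m' ∧ (T.erase m').card ≤ max (T.card - 1) 1 := by
    by_cases h : 1 < T.card
    · obtain ⟨m', h1, h2⟩ := exists_mem_ne h m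
      exact ⟨m', h2.symm, by rw [card_erase_of_mem h1]; exact le_max_left _ _⟩
    · obtain ⟨m', h2⟩ := exists_ne m
      exact ⟨m', h2.symm, (card_le_card (erase_subset _ _)).trans
        ((not_lt.1 h).trans (le_max_right _ _))⟩
  set d := max (T.card - 1) 1 with hd
  have hdn : (n + 1) * d + r ≤ p := by
    rcases max_choice (T.card - 1) 1 with h | h <;> rw [hd, h]
    · rcases Nat.eq_zero_or_pos T.card with h0 | h0
      · rw [h0]; omega
      obtain ⟨t, ht⟩ := Nat.exists_eq_succ_of_ne_zero h0.ne'
      rw [ht, Nat.succ_sub_one]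
      rw [ht, Nat.cast_succ, add_comm, add_le_add_iff_left, le_div_iff₀ (by positivity),
        le_sub_iff_add_le] at hD
      rw [mul_comm]
      exact_mod_cast hD
    · omega
  obtain ⟨f, hinj, hne, hf⟩ := exists_injective_slope hm'
  set S : Finset (ZMod p) := univ.filter fun y => IsSpecialDir p U (f y) with hS
  have hSd : S.card ≤ d := by
    rw [← card_image_of_injective S hinj]
    refine (card_le_card fun k hk => ?_).trans hT'
    obtain ⟨y, hy, rfl⟩ := mem_image.1 hk
    exact mem_erase.2 ⟨hne y, mem_filter.2 ⟨mem_univ _, (mem_filter.1 hy).2⟩⟩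
  have hdp : d ≤ p := by nlinarith
  obtain ⟨Y, hYS, hY⟩ := exists_subset_card_eq (s := Sᶜ) (n := p - d) (by
    rw [card_compl, ZMod.card]; omega)
  have h0 := fiberCard_eq_card_inter (U := U) (m := m) (e := slopeForm m') (g := slopeForm m)
    (y := 0) one_ne_zero (fun q => by ring)
  simp only [div_one] at h0
  obtain ⟨α, s, h1, h2⟩ := exists_card_add_le_and_fiberCard_le (a := slopeForm m')
    (b := slopeForm m) hU (by omega) (le_max_right _ _) hdn Y (by omega) (fun y hy x => by
      obtain ⟨l, hl, hq⟩ := hf y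
      rw [fiberCard_eq_card_inter hl hq]
      have hns : ¬ IsSpecialDir p U (f y) := by simpa [hS] using hYS hy
      rw [IsSpecialDir, not_exists] at hns
      have := hns (x / l)
      rw [not_or, isRich_iff hU (by omega)] at this
      exact ⟨by omega, le_card_add_one_of_not_isPoor hU (by omega) this.2⟩)
    fun x => by
      rw [h0]
      exact (card_le_card inter_subset_left).trans (card_lineWithSlope_le m x)
  exact ⟨α, s, h1, fun x hx => h0 x ▸ h2 x hx⟩

end Directions

theorem poly_method_output (p n r : ℕ) [Fact p.Prime]
    (U : Finset (ZMod p × ZMod p))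
    (hn : 1 ≤ n) (hnp : n < p) (hr : r + n < p)
    (hcard : (U.card : ℤ) = n * p - r)
    (hlines : ¬ ∃ L : Fin n → Option (ZMod p) × ZMod p,
      ∀ u ∈ U, ∃ i : Fin n, u ∈ lineWithSlope p (L i).1 (L i).2)
    (hD : (({m : Option (ZMod p) | IsSpecialDir p U m}.ncard : ℚ))
        ≤ 1 + ((p : ℚ) - r) / (n + 1))
    (m : Option (ZMod p)) (hm : IsRichDir p U m)
    (w : ℕ) (hw : w = {c : ZMod p | IsRich p U (lineWithSlope p m c)}.ncard) :
    (∀ c : ZMod p, ¬ IsRich p U (lineWithSlope p m c) →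
        ((lineWithSlope p m c ∩ U).card : ℤ) ≤ (n : ℤ) - w) ∧
    (∀ c : ZMod p, IsRich p U (lineWithSlope p m c) →
        (p : ℤ) - r + n - 1 ≤ ((lineWithSlope p m c ∩ U).card : ℤ)) ∧
    (w : ℤ) ≤ (n : ℤ) - 1 ∧
    ((w : ℤ) * ((n : ℤ) - w) ≤ r ∧ (n : ℤ) - 1 ≤ (w : ℤ) * ((n : ℤ) - w)) := by
  have hU : U.card + r = n * p := by zify; linarith
  obtain ⟨α, s, hs, hks⟩ := exists_card_add_le_and_card_inter_le hU hr hn hD m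
  have hα : α ≠ 0 := by
    rintro rfl
    obtain ⟨t, hst, ht⟩ := exists_superset_card_eq (s := s) (n := n) (by simpa using hs)
      (by rw [ZMod.card]; exact hnp.le)
    refine hlines ⟨fun i => (m, (t.equivFinOfCardEq ht).symm i), fun u hu => ?_⟩
    have hus : slopeForm m u ∈ t := hst (by
      by_contra h
      have := card_eq_zero.1 (Nat.le_zero.1 (hks _ h))
      exact notMem_empty u (this ▸ mem_inter.2 ⟨mem_lineWithSlope_iff.2 rfl, hu⟩))
    exact ⟨t.equivFinOfCardEq ht ⟨_, hus⟩, by simp [mem_lineWithSlope_iff]⟩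
  have hrp : r < p := by omega
  obtain ⟨heq, hs1, hks', hsr⟩ := structure_of_sum_eq (ZMod.card p)
    (by rw [sum_card_lineWithSlope_inter m, hU])
    (fun x => (card_le_card inter_subset_left).trans (card_lineWithSlope_le m x)) hrp hs hks
    (by
      obtain ⟨c, hc⟩ := hm
      exact ⟨c, (isRich_iff hU hrp).1 hc⟩)
  have hsα : n ≤ s.card * α + 1 := by
    obtain ⟨i, hi⟩ := Nat.exists_eq_add_of_le hs1
    obtain ⟨j, hj⟩ := Nat.exists_eq_succ_of_ne_zero hα
    rw [← heq, hi, hj]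
    nlinarith [Nat.zero_le (i * j)]
  have hrich : ∀ c, IsRich p U (lineWithSlope p m c) ↔ c ∈ s := by
    intro c
    rw [isRich_iff hU hrp]
    refine ⟨fun h => ?_, fun h => ?_⟩
    · by_contra hc
      have := hks c hc
      omega
    · have := hks' c h
      omega
  have hws : w = s.card := by
    rw [hw, ← Set.ncard_coe_finset]
    congr
    ext c
    exact hrich c
  have hnα : (n : ℤ) - w = α := by omega
  rw [hnα, hws]
  refine ⟨fun c hc => ?_, fun c hc => ?_, by omega, by exact_mod_cast hsr, by
    zify at hsα; linarith⟩
  · exact_mod_cast hks c (mt (hrich c).2 hc)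
  · have := hks' c ((hrich c).1 hc)
    zify at this hsα
    linarith
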